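/- arXiv:1711.08908 — 2 statements merged into one kernel-verified Lean document; each statement's English description precedes it below -/
import Mathlib

section
/- Let n ≥ 1 with largest binary digit 2^{a_1} (i.e. 2^{a_1} ≤ n < 2^{a_1+1}), and let λ be a partition of n. Then λ is odd if and only if λ contains a hook h of length 2^{a_1} such that the partition λ∖h obtained by removing h is odd. -/
namespace OddSym

open scoped Classical

/-- Remove one box from a row of size `p` (as multisets of parts). -/
def removeBox (lam : Multiset ℕ) (p : ℕ) : Multiset ℕ :=
  if p ≤ 1 then lam.erase p else (p - 1) ::ₘ lam.erase p

lemma removeBox_sum_lt {lam : Multiset ℕ} {p : ℕ} (hp : p ∈ lam) (h0 : 0 < p) :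
    (removeBox lam p).sum < lam.sum := by
  have h : p + (lam.erase p).sum = lam.sum := by
    conv_rhs => rw [← Multiset.cons_erase hp]
    simp [Multiset.sum_cons]
  unfold removeBox
  split
  · omega
  · simp only [Multiset.sum_cons]
    omega

/-- The number of standard Young tableaux of shape `lam`
(equivalently, the degree of the irreducible character of the symmetric
group labelled by `lam`), defined via the branching rule. -/
def degSYT (lam : Multiset ℕ) : ℕ :=
  if _h : lam = 0 then 1
  else ∑ p ∈ (lam.toFinset.filter (fun p => 0 < p)).attach, degSYT (removeBox lam p.1)
termination_by lam.sum
decreasing_by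
  have hp := p.2
  simp only [Finset.mem_filter, Multiset.mem_toFinset] at hp
  exact removeBox_sum_lt hp.1 hp.2

/-- `lam` is an odd partition: all parts positive and the number of standard
Young tableaux of shape `lam` (= the character degree) is odd. -/
def OddP (lam : Multiset ℕ) : Prop :=
  (∀ x ∈ lam, 0 < x) ∧ Odd (degSYT lam)

/-- The parts of `lam` sorted in weakly decreasing order. -/
def descList (lam : Multiset ℕ) : List ℕ :=
  (lam.sort (· ≤ ·)).reverse

/-- The beta-set (set of beta-numbers) of `lam` with `m` beads:
`{ lam_i + (m - i) : 1 ≤ i ≤ m }` where `lam` is padded with zero parts. -/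
def betaSet (lam : Multiset ℕ) (m : ℕ) : Finset ℕ :=
  (Finset.range m).image (fun i => (descList lam).getD i 0 + (m - 1 - i))

/-- `mu` is obtained from `lam` by removing an `e`-hook: in some beta-set of
`lam` a beta-number `x` is replaced by `x - e` (which is not a beta-number). -/
def IsHookRemoval (e : ℕ) (lam mu : Multiset ℕ) : Prop :=
  (∀ x ∈ lam, 0 < x) ∧ (∀ x ∈ mu, 0 < x) ∧ 0 < e ∧
  ∃ m x, Multiset.card lam ≤ m ∧ Multiset.card mu ≤ m ∧
    x ∈ betaSet lam m ∧ e ≤ x ∧ x - e ∉ betaSet lam m ∧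
    betaSet mu m = insert (x - e) ((betaSet lam m).erase x)

/-- The map `f_k` : for an odd partition `lam` with `2^k ≤ |lam|`, the unique
odd partition obtained from `lam` by removing a `2^k`-hook (junk value `0` if
no such partition exists). -/
noncomputable def fkOp (k : ℕ) (lam : Multiset ℕ) : Multiset ℕ :=
  if h : ∃ mu, IsHookRemoval (2 ^ k) lam mu ∧ OddP mu then h.choose else 0

/-- The partition encoded by a finite beta-set: each bead contributes a part
equal to the number of gaps below it. -/
def partOfBeta (S : Finset ℕ) : Multiset ℕ :=
  (S.val.map (fun b => b - (S.filter (fun a => a < b)).card)).filter (fun p => 0 < p)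

/-- The 2-quotient `(lam_0, lam_1)` of `lam`, computed from a beta-set with an
even number of beads via the two runners of the 2-abacus. -/
def quot2 (lam : Multiset ℕ) : Multiset ℕ × Multiset ℕ :=
  (partOfBeta (((betaSet lam (2 * Multiset.card lam)).filter (fun b => b % 2 = 0)).image
      (fun b => b / 2)),
   partOfBeta (((betaSet lam (2 * Multiset.card lam)).filter (fun b => b % 2 = 1)).image
      (fun b => b / 2)))

/-- The `e`-core of `lam`: push all beads of an `e`-abacus configuration for
`lam` up as far as possible. -/
def coreP (e : ℕ) (lam : Multiset ℕ) : Multiset ℕ :=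
  partOfBeta ((Finset.range (e * (Multiset.card lam + e))).filter
    (fun x => x / e <
      ((betaSet lam (Multiset.card lam + e)).filter (fun b => b % e = x % e)).card))

/-- Row `k` of the 2-quotient tower of `lam`: row 0 is `[lam]`, and row `k+1`
replaces each entry of row `k` by its 2-quotient pair. -/
def towerRow : ℕ → Multiset ℕ → List (Multiset ℕ)
  | 0, lam => [lam]
  | (k + 1), lam => (towerRow k lam).flatMap (fun mu => [(quot2 mu).1, (quot2 mu).2])

/-- `R_k^j(lam)`: the component of row `k` of the 2-quotient tower of `lam`
from which a `2^(j-k)`-hook is removed in the passage from `lam` to `f_j(lam)`;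
it is characterized by: row `k` for `f_j(lam)` is obtained from row `k` for
`lam` by replacing this component by its image under `f_(j-k)`. -/
noncomputable def Rcomp (k j : ℕ) (lam : Multiset ℕ) : Multiset ℕ :=
  if h : ∃ s, s < 2 ^ k ∧
      towerRow k (fkOp j lam) =
        (towerRow k lam).set s (fkOp (j - k) ((towerRow k lam).getD s 0))
  then (towerRow k lam).getD h.choose 0 else 0


/-- The coefficient, modulo two, of the monomial with exponents `t` in the product of the
Vandermonde determinant and the `k`-th power of the sum of the variables. -/
noncomputable def altCoeff {m : ℕ} (k : ℕ) (t : Fin m → ℕ) : ZMod 2 :=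
  MvPolynomial.coeff (Finsupp.equivFunOnFinite.symm t)
    ((∑ σ : Equiv.Perm (Fin m),
      MvPolynomial.monomial (Finsupp.equivFunOnFinite.symm fun i => (σ i : ℕ)) (1 : ZMod 2)) *
      (∑ i, MvPolynomial.X i) ^ k)

lemma altCoeff_zero {m : ℕ} (t : Fin m → ℕ) :
    altCoeff 0 t = if ∃ σ : Equiv.Perm (Fin m), (fun i => (σ i : ℕ)) = t then 1 else 0 := by
  simp only [altCoeff, pow_zero, mul_one, MvPolynomial.coeff_sum, MvPolynomial.coeff_monomial,
    EmbeddingLike.apply_eq_iff_eq]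
  split_ifs with h
  · obtain ⟨σ, rfl⟩ := h
    rw [Finset.sum_eq_single σ]
    · simp
    · intro τ _ hτ
      refine if_neg fun h => hτ (Equiv.ext fun i => Fin.ext (congrFun h i))
    · simp
  · exact Finset.sum_eq_zero fun σ _ => if_neg fun hσ => h ⟨σ, hσ⟩

lemma altCoeff_add_two_pow {m : ℕ} (k a : ℕ) (t : Fin m → ℕ) :
    altCoeff (k + 2 ^ a) t =
      ∑ i, if 2 ^ a ≤ t i then altCoeff k (Function.update t i (t i - 2 ^ a)) else 0 := by
  have hX (i : Fin m) : (MvPolynomial.X i : MvPolynomial (Fin m) (ZMod 2)) ^ 2 ^ a =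
      MvPolynomial.monomial (Finsupp.single i (2 ^ a)) 1 := MvPolynomial.X_pow_eq_monomial
  simp only [altCoeff]
  rw [pow_add, sum_pow_char_pow, ← mul_assoc, Finset.mul_sum, MvPolynomial.coeff_sum]
  refine Finset.sum_congr rfl fun i _ => ?_
  rw [hX, MvPolynomial.coeff_mul_monomial']
  simp only [Finsupp.single_le_iff, Finsupp.equivFunOnFinite_symm_apply_apply, mul_one]
  refine if_congr Iff.rfl ?_ rfl
  congr 1
  ext j
  by_cases hj : j = i
  · subst hj; simp
  · simp [Function.update_of_ne hj, Finsupp.single_eq_of_ne hj]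

lemma altCoeff_succ {m : ℕ} (k : ℕ) (t : Fin m → ℕ) :
    altCoeff (k + 1) t =
      ∑ i, if 1 ≤ t i then altCoeff k (Function.update t i (t i - 1)) else 0 := by
  simpa using altCoeff_add_two_pow k 0 t

lemma altCoeff_comp_perm {m : ℕ} (k : ℕ) (t : Fin m → ℕ) (σ : Equiv.Perm (Fin m)) :
    altCoeff k (t ∘ σ) = altCoeff k t := by
  induction k generalizing t with
  | zero =>
    rw [altCoeff_zero, altCoeff_zero]
    refine if_congr ⟨?_, ?_⟩ rfl rfl
    · rintro ⟨τ, h⟩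
      exact ⟨σ.symm.trans τ, funext fun i => by simpa using congrFun h (σ.symm i)⟩
    · rintro ⟨τ, rfl⟩
      exact ⟨σ.trans τ, rfl⟩
  | succ k ih =>
    rw [altCoeff_succ, altCoeff_succ]
    refine Fintype.sum_equiv σ _ _ fun i => if_congr Iff.rfl ?_ rfl
    rw [← ih (Function.update t (σ i) _)]
    congr 1
    rw [Function.update_comp_eq_of_injective _ σ.injective]
    rfl

lemma altCoeff_eq_zero_of_eq {m : ℕ} (k : ℕ) (t : Fin m → ℕ) {i j : Fin m} (hij : i ≠ j)
    (h : t i = t j) : altCoeff k t = 0 := by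
  induction k generalizing t with
  | zero =>
    rw [altCoeff_zero]
    refine if_neg ?_
    rintro ⟨σ, rfl⟩
    exact hij (σ.injective (Fin.ext h))
  | succ k ih =>
    rw [altCoeff_succ, Finset.sum_eq_add i j hij]
    · have hswap : Function.update t j (t j - 1) =
          Function.update t i (t i - 1) ∘ Equiv.swap i j := by
        funext l
        by_cases hl : l = i
        · subst hl; simp [Function.update_of_ne hij, Function.update_of_ne hij.symm, h]
        · by_cases hl' : l = j
          · subst hl'; simp [h]
          · simp [Equiv.swap_apply_of_ne_of_ne hl hl', Function.update_of_ne hl,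
              Function.update_of_ne hl']
      rw [hswap, altCoeff_comp_perm, h]
      exact CharTwo.add_self_eq_zero _
    · rintro l - ⟨hi, hj⟩
      rw [ih _ (by simpa [Function.update_of_ne hi.symm, Function.update_of_ne hj.symm] using h),
        ite_self]
    · simp
    · simp

lemma altCoeff_eq_of_image_eq {m : ℕ} (k : ℕ) {s t : Fin m → ℕ} (hs : Function.Injective s)
    (ht : Function.Injective t) (h : Set.range s = Set.range t) : altCoeff k s = altCoeff k t := by
  have hσ : s = t ∘ ((Equiv.ofInjective s hs).trans
      ((Equiv.setCongr h).trans (Equiv.ofInjective t ht).symm)) := by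
    funext i
    simp [Equiv.apply_ofInjective_symm]
  rw [hσ, altCoeff_comp_perm]

/-- The `i`-th largest part of `lam`, counting from zero, or zero if there is none. -/
def rowLen (lam : Multiset ℕ) (i : ℕ) : ℕ := (descList lam).getD i 0

lemma length_descList (lam : Multiset ℕ) : (descList lam).length = Multiset.card lam := by
  simp [descList]

lemma rowLen_antitone (lam : Multiset ℕ) : Antitone (rowLen lam) := by
  have h : (descList lam).Pairwise (· ≥ ·) := by
    rw [descList, List.pairwise_reverse]
    exact Multiset.pairwise_sort lam (· ≤ ·)
  intro i j hij
  rcases hij.eq_or_lt with rfl | hij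
  · exact le_rfl
  by_cases hj : j < (descList lam).length
  · rw [rowLen, rowLen, List.getD_eq_getElem _ _ hj, List.getD_eq_getElem _ _ (hij.trans hj)]
    exact List.pairwise_iff_getElem.1 h i j _ hj hij
  · rw [rowLen, List.getD_eq_default _ _ (not_lt.1 hj)]
    exact Nat.zero_le _

lemma map_rowLen_range_card (lam : Multiset ℕ) :
    (Multiset.range (Multiset.card lam)).map (rowLen lam) = lam := by
  have h : (List.range (descList lam).length).map (rowLen lam) = descList lam := by
    refine List.ext_getElem (by simp) fun i h₁ h₂ => ?_
    simp [rowLen, List.getElem?_eq_getElem h₂]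
  have h' := congrArg (fun l : List ℕ => (l : Multiset ℕ)) h
  simpa [length_descList, descList, Multiset.range] using h'

lemma rowLen_eq_zero {lam : Multiset ℕ} {i : ℕ} (h : Multiset.card lam ≤ i) :
    rowLen lam i = 0 :=
  List.getD_eq_default _ _ (by rwa [length_descList])

lemma map_rowLen_range {lam : Multiset ℕ} {m : ℕ} (hm : Multiset.card lam ≤ m) :
    (Multiset.range m).map (rowLen lam) = lam + Multiset.replicate (m - Multiset.card lam) 0 := by
  obtain ⟨d, rfl⟩ := Nat.exists_eq_add_of_le hm
  induction d with
  | zero => simp [map_rowLen_range_card]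
  | succ d ih =>
    rw [← add_assoc, Multiset.range_succ, Multiset.map_cons, ih (by omega),
      rowLen_eq_zero (by omega), Nat.add_sub_cancel_left, add_assoc, Nat.add_sub_cancel_left,
      Multiset.replicate_succ, Multiset.add_cons]

lemma filter_map_rowLen {lam : Multiset ℕ} {m : ℕ} (hpos : ∀ x ∈ lam, 0 < x)
    (hm : Multiset.card lam ≤ m) :
    ((Multiset.range m).map (rowLen lam)).filter (0 < ·) = lam := by
  rw [map_rowLen_range hm, Multiset.filter_add, Multiset.filter_eq_self.2 hpos]
  simpa using fun a => Multiset.eq_of_mem_replicate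

lemma lt_iff_lt_card_filter {f : ℕ → ℕ} {m i j : ℕ}
    (hf : ∀ a b, a ≤ b → b < m → f b ≤ f a) (hi : i < m) :
    j < f i ↔ i < Multiset.card (((Multiset.range m).map f).filter (j < ·)) := by
  have hcard : Multiset.card (((Multiset.range m).map f).filter (j < ·)) =
      ((Finset.range m).filter (fun a => j < f a)).card := by
    rw [Multiset.filter_map, Multiset.card_map]
    rfl
  rw [hcard]
  constructor
  · intro h
    have : Finset.range (i + 1) ⊆ (Finset.range m).filter (fun a => j < f a) := fun a ha => by
      have := Finset.mem_range.1 ha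
      exact Finset.mem_filter.2 ⟨Finset.mem_range.2 (by omega),
        h.trans_le (hf a i (by omega) hi)⟩
    simpa using Finset.card_le_card this
  · intro h
    by_contra hj
    have : (Finset.range m).filter (fun a => j < f a) ⊆ Finset.range i := fun a ha => by
      obtain ⟨ha, hja⟩ := Finset.mem_filter.1 ha
      by_contra hia
      have := hf i a (by simpa using hia) (Finset.mem_range.1 ha)
      omega
    have := Finset.card_le_card this
    simp at this
    omega

lemma eq_rowLen {lam : Multiset ℕ} {f : ℕ → ℕ} {m i : ℕ} (hpos : ∀ x ∈ lam, 0 < x)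
    (hm : Multiset.card lam ≤ m) (hf : ∀ a b, a ≤ b → b < m → f b ≤ f a)
    (h : ((Multiset.range m).map f).filter (0 < ·) = lam) (hi : i < m) :
    rowLen lam i = f i := by
  have key (j : ℕ) : j < rowLen lam i ↔ j < f i := by
    rw [lt_iff_lt_card_filter (fun a b hab _ => rowLen_antitone lam hab) hi,
      lt_iff_lt_card_filter hf hi]
    have hfil (s : Multiset ℕ) : s.filter (j < ·) = (s.filter (0 < ·)).filter (j < ·) := by
      rw [Multiset.filter_filter]
      exact Multiset.filter_congr fun x _ => by omega
    rw [hfil, hfil ((Multiset.range m).map f), h, filter_map_rowLen hpos hm]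
  have h₁ := key (rowLen lam i)
  have h₂ := key (f i)
  omega

lemma mem_iff_exists_rowLen {lam : Multiset ℕ} {m p : ℕ} (hm : Multiset.card lam ≤ m)
    (hp : 0 < p) : p ∈ lam ↔ ∃ i < m, rowLen lam i = p := by
  have h : p ∈ lam ↔ p ∈ (Multiset.range m).map (rowLen lam) := by
    rw [map_rowLen_range hm, Multiset.mem_add, Multiset.mem_replicate]
    simp [hp.ne']
  rw [h]
  simp

lemma sum_rowLen {lam : Multiset ℕ} {m : ℕ} (hm : Multiset.card lam ≤ m) :
    ∑ i : Fin m, rowLen lam i = lam.sum := by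
  rw [Fin.sum_univ_eq_sum_range (rowLen lam) m]
  have h : ((Multiset.range m).map (rowLen lam)).sum = lam.sum := by
    rw [map_rowLen_range hm]
    simp
  exact h

/-- The beta-numbers of `lam` with `m` beads, in decreasing order. -/
def betaTuple (lam : Multiset ℕ) (m : ℕ) (i : Fin m) : ℕ := rowLen lam i + (m - 1 - i)

lemma betaTuple_strictAnti (lam : Multiset ℕ) (m : ℕ) : StrictAnti (betaTuple lam m) := by
  intro i j hij
  have h₁ := rowLen_antitone lam hij.le
  have h₂ : (i : ℕ) < j := hij
  have := j.isLt
  simp only [betaTuple]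
  omega

lemma betaSet_eq_image (lam : Multiset ℕ) (m : ℕ) :
    betaSet lam m = Finset.univ.image (betaTuple lam m) := by
  ext x
  simp only [betaSet, betaTuple, rowLen, Finset.mem_image, Finset.mem_range, Finset.mem_univ,
    true_and]
  exact ⟨fun ⟨i, hi, h⟩ => ⟨⟨i, hi⟩, h⟩, fun ⟨i, h⟩ => ⟨i, i.isLt, h⟩⟩

lemma card_betaSet (lam : Multiset ℕ) (m : ℕ) : (betaSet lam m).card = m := by
  rw [betaSet_eq_image, Finset.card_image_of_injective _ (betaTuple_strictAnti lam m).injective]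
  simp

lemma sum_betaSet {lam : Multiset ℕ} {m : ℕ} (hm : Multiset.card lam ≤ m) :
    ∑ x ∈ betaSet lam m, x = lam.sum + ∑ i ∈ Finset.range m, i := by
  rw [betaSet_eq_image, Finset.sum_image (betaTuple_strictAnti lam m).injective.injOn]
  simp only [betaTuple]
  rw [Finset.sum_add_distrib, sum_rowLen hm,
    Fin.sum_univ_eq_sum_range (fun i => m - 1 - i) m, Finset.sum_range_reflect (fun i => i) m]

lemma exists_betaSet_eq (S : Finset ℕ) :
    ∃ mu : Multiset ℕ, (∀ x ∈ mu, 0 < x) ∧ Multiset.card mu ≤ S.card ∧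
      betaSet mu S.card = S := by
  have hS : ∀ k < S.card, ∀ hf : (Set.ofPred (· ∈ S)).Finite, k < hf.toFinset.card := by
    intro k hk hf
    convert hk
    ext x
    simp
  have hle : ∀ k < S.card, k ≤ Nat.nth (· ∈ S) k := fun k hk => by
    conv_lhs => rw [← Nat.count_nth (hS k hk)]
    exact Nat.count_le _
  have hstep : ∀ k l, k ≤ l → l < S.card →
      Nat.nth (· ∈ S) k + (l - k) ≤ Nat.nth (· ∈ S) l := by
    intro k l hkl hl
    induction l, hkl using Nat.le_induction with
    | base => simp
    | succ l hkl ih =>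
      have h₁ := ih (by omega)
      have h₂ := Nat.nth_lt_nth' (show l < l + 1 by omega) (hS (l + 1) hl)
      omega
  set m := S.card
  set f : ℕ → ℕ := fun i => Nat.nth (· ∈ S) (m - 1 - i) - (m - 1 - i) with hf
  have hanti : ∀ a b, a ≤ b → b < m → f b ≤ f a := by
    intro a b hab hb
    have h₁ := hstep (m - 1 - b) (m - 1 - a) (by omega) (by omega)
    have h₂ := hle (m - 1 - b) (by omega)
    simp only [hf]
    omega
  have hpos : ∀ x ∈ ((Multiset.range m).map f).filter (0 < ·), 0 < x :=
    fun x hx => (Multiset.mem_filter.1 hx).2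
  have hcard : Multiset.card (((Multiset.range m).map f).filter (0 < ·)) ≤ m :=
    (Multiset.card_le_card (Multiset.filter_le _ _)).trans (by simp)
  refine ⟨_, hpos, hcard, Finset.eq_of_subset_of_card_le ?_ (card_betaSet _ _).ge⟩
  rw [betaSet_eq_image]
  intro x hx
  obtain ⟨i, -, rfl⟩ := Finset.mem_image.1 hx
  have hi := i.isLt
  have h₁ := hle (m - 1 - i) (by omega)
  have h₂ : betaTuple (((Multiset.range m).map f).filter (0 < ·)) m i =
      Nat.nth (· ∈ S) (m - 1 - i) := by
    rw [betaTuple, eq_rowLen hpos hcard hanti rfl hi]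
    simp only [hf]
    omega
  rw [h₂]
  exact Nat.nth_mem _ (hS _ (by omega))

lemma sum_range_card_le_sum (S : Finset ℕ) : ∑ i ∈ Finset.range S.card, i ≤ ∑ x ∈ S, x := by
  obtain ⟨mu, -, hcard, hmu⟩ := exists_betaSet_eq S
  have := sum_betaSet hcard
  rw [hmu] at this
  omega

lemma removeBox_pos {lam : Multiset ℕ} (hpos : ∀ x ∈ lam, 0 < x) (p : ℕ) :
    ∀ x ∈ removeBox lam p, 0 < x := by
  intro x hx
  unfold removeBox at hx
  split_ifs at hx with h
  · exact hpos x (Multiset.mem_of_mem_erase hx)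
  · rcases Multiset.mem_cons.1 hx with rfl | hx
    · omega
    · exact hpos x (Multiset.mem_of_mem_erase hx)

lemma card_removeBox_le {lam : Multiset ℕ} {p : ℕ} (hp : p ∈ lam) :
    Multiset.card (removeBox lam p) ≤ Multiset.card lam := by
  have h := Multiset.card_erase_add_one hp
  unfold removeBox
  split_ifs
  · omega
  · rw [Multiset.card_cons, h]

lemma sum_removeBox {lam : Multiset ℕ} {p : ℕ} (hp : p ∈ lam) (h0 : 0 < p) :
    (removeBox lam p).sum + 1 = lam.sum := by
  have h := Multiset.sum_erase hp
  unfold removeBox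
  split_ifs
  · omega
  · rw [Multiset.sum_cons]
    omega

lemma rowLen_removeBox {lam : Multiset ℕ} {m i j : ℕ} (hpos : ∀ x ∈ lam, 0 < x)
    (hm : Multiset.card lam ≤ m) (hi : i < m) (h : rowLen lam (i + 1) < rowLen lam i)
    (hj : j < m) :
    rowLen (removeBox lam (rowLen lam i)) j =
      Function.update (rowLen lam) i (rowLen lam i - 1) j := by
  have hmem : rowLen lam i ∈ lam :=
    (mem_iff_exists_rowLen hm (Nat.zero_lt_of_lt h)).2 ⟨i, hi, rfl⟩
  refine eq_rowLen (removeBox_pos hpos _) ((card_removeBox_le hmem).trans hm) ?_ ?_ hj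
  · intro a b hab _
    have h₁ := rowLen_antitone lam hab
    rcases eq_or_ne a i with ha | ha <;> rcases eq_or_ne b i with hb | hb
    · rw [ha, hb]
    · rw [ha, Function.update_self, Function.update_of_ne hb]
      have := rowLen_antitone lam (show i + 1 ≤ b by omega)
      omega
    · subst hb
      rw [Function.update_self, Function.update_of_ne ha]
      omega
    · rwa [Function.update_of_ne ha, Function.update_of_ne hb]
  · have hR : Multiset.range m = i ::ₘ (Multiset.range m).erase i :=
      (Multiset.cons_erase (Multiset.mem_range.2 hi)).symm
    have hnot : i ∉ (Multiset.range m).erase i := (Multiset.nodup_range m).notMem_erase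
    have hlam := filter_map_rowLen hpos hm
    rw [hR, Multiset.map_cons, Multiset.filter_cons_of_pos _ (Nat.zero_lt_of_lt h)] at hlam
    have herase : lam.erase (rowLen lam i) =
        (((Multiset.range m).erase i).map (rowLen lam)).filter (0 < ·) :=
      (congrArg (Multiset.erase · (rowLen lam i)) hlam).symm.trans (Multiset.erase_cons_head _ _)
    have hmap : ((Multiset.range m).erase i).map
        (Function.update (rowLen lam) i (rowLen lam i - 1)) =
        ((Multiset.range m).erase i).map (rowLen lam) :=
      Multiset.map_congr rfl fun x hx =>
        Function.update_of_ne (ne_of_mem_of_not_mem hx hnot) _ _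
    rw [hR, Multiset.map_cons, hmap, Function.update_self, removeBox, herase]
    split_ifs with h'
    · exact Multiset.filter_cons_of_neg _ (by omega)
    · exact Multiset.filter_cons_of_pos _ (by omega)

lemma betaTuple_removeBox {lam : Multiset ℕ} {m : ℕ} {i : Fin m} (hpos : ∀ x ∈ lam, 0 < x)
    (hm : Multiset.card lam ≤ m) (h : rowLen lam (i + 1) < rowLen lam i) :
    betaTuple (removeBox lam (rowLen lam i)) m =
      Function.update (betaTuple lam m) i (betaTuple lam m i - 1) := by
  funext j
  rw [betaTuple, rowLen_removeBox hpos hm i.isLt h j.isLt]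
  rcases eq_or_ne j i with rfl | hj
  · simp only [Function.update_self, betaTuple]
    omega
  · rw [Function.update_of_ne hj, Function.update_of_ne (Fin.val_ne_of_ne hj), betaTuple]

lemma degSYT_of_ne_zero {lam : Multiset ℕ} (h : lam ≠ 0) :
    degSYT lam = ∑ p ∈ lam.toFinset.filter (0 < ·), degSYT (removeBox lam p) := by
  rw [degSYT, dif_neg h]
  exact Finset.sum_attach _ fun p => degSYT (removeBox lam p)

/-- Frobenius' formula for the number of standard Young tableaux, modulo two. -/
lemma degSYT_eq_altCoeff {lam : Multiset ℕ} {m : ℕ} (hpos : ∀ x ∈ lam, 0 < x)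
    (hm : Multiset.card lam ≤ m) : (degSYT lam : ZMod 2) = altCoeff lam.sum (betaTuple lam m) := by
  obtain ⟨k, hk⟩ : ∃ k, lam.sum = k := ⟨_, rfl⟩
  induction k generalizing lam with
  | zero =>
    have hlam : lam = 0 := Multiset.eq_zero_of_forall_notMem fun x hx =>
      (hpos x hx).ne' (Multiset.sum_eq_zero_iff.1 hk x hx)
    subst hlam
    rw [degSYT, dif_pos rfl, Multiset.sum_zero, altCoeff_zero, if_pos]
    · simp
    · refine ⟨Fin.revPerm, funext fun i => ?_⟩
      rw [betaTuple, rowLen_eq_zero (by simp), Fin.revPerm_apply, Fin.val_rev]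
      omega
  | succ k ih =>
    have hlam : lam ≠ 0 := by
      rintro rfl
      simp at hk
    have hmem {i : Fin m} (h : rowLen lam (i + 1) < rowLen lam i) : rowLen lam i ∈ lam :=
      (mem_iff_exists_rowLen hm (Nat.zero_lt_of_lt h)).2 ⟨i, i.isLt, rfl⟩
    rw [degSYT_of_ne_zero hlam, hk, altCoeff_succ, Nat.cast_sum,
      ← Finset.sum_subset (Finset.subset_univ
        (Finset.univ.filter fun i : Fin m => rowLen lam (i + 1) < rowLen lam i))]
    · symm
      refine Finset.sum_bij (fun i _ => rowLen lam i) ?_ ?_ ?_ ?_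
      · intro i hi
        have h := (Finset.mem_filter.1 hi).2
        exact Finset.mem_filter.2 ⟨Multiset.mem_toFinset.2 (hmem h), Nat.zero_lt_of_lt h⟩
      · intro i hi j hj hij
        have hi := (Finset.mem_filter.1 hi).2
        have hj := (Finset.mem_filter.1 hj).2
        by_contra hne
        rcases lt_or_gt_of_ne hne with hlt | hlt
        · have := rowLen_antitone lam (show (i : ℕ) + 1 ≤ j from hlt)
          omega
        · have := rowLen_antitone lam (show (j : ℕ) + 1 ≤ i from hlt)
          omega
      · intro p hp
        obtain ⟨hp, h0⟩ := Finset.mem_filter.1 hp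
        obtain ⟨i, hi, rfl⟩ := (mem_iff_exists_rowLen hm h0).1 (Multiset.mem_toFinset.1 hp)
        let P : ℕ → Prop := fun j => rowLen lam j = rowLen lam i
        have hPi : P i := rfl
        have hP : P (Nat.findGreatest P m) := Nat.findGreatest_spec hi.le hPi
        have hlt : Nat.findGreatest P m < m := by
          by_contra hge
          have := rowLen_eq_zero (hm.trans (not_lt.1 hge))
          have hP' : rowLen lam (Nat.findGreatest P m) = rowLen lam i := hP
          omega
        refine ⟨⟨Nat.findGreatest P m, hlt⟩, Finset.mem_filter.2 ⟨Finset.mem_univ _, ?_⟩, hP⟩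
        refine lt_of_le_of_ne (rowLen_antitone lam (Nat.le_succ _)) fun heq => ?_
        exact Nat.findGreatest_is_greatest (Nat.lt_succ_self (Nat.findGreatest P m)) hlt
          (heq.trans hP)
      · intro i hi
        have h := (Finset.mem_filter.1 hi).2
        have hsum := sum_removeBox (hmem h) (Nat.zero_lt_of_lt h)
        rw [if_pos (by rw [betaTuple]; omega), ← betaTuple_removeBox hpos hm h,
          ih (removeBox_pos hpos _) ((card_removeBox_le (hmem h)).trans hm) (by omega)]
        congr 1
        omega
    · intro i _ hi
      have hle : rowLen lam i ≤ rowLen lam (i + 1) := by simpa using hi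
      have heq := hle.antisymm (rowLen_antitone lam (Nat.le_succ i))
      have := i.isLt
      by_cases him : (i : ℕ) + 1 < m
      · have hne : i ≠ ⟨i + 1, him⟩ := fun h => by simpa using congrArg Fin.val h
        rw [altCoeff_eq_zero_of_eq _ _ hne, ite_self]
        rw [Function.update_self, Function.update_of_ne hne.symm]
        simp only [betaTuple]
        omega
      · refine if_neg ?_
        have := rowLen_eq_zero (show Multiset.card lam ≤ i + 1 by omega)
        rw [betaTuple]
        omega

lemma sum_insert_erase {S : Finset ℕ} {x e : ℕ} (hx : x ∈ S) (he : e ≤ x) (h : x - e ∉ S) :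
    ∑ y ∈ insert (x - e) (S.erase x), y + e = ∑ y ∈ S, y := by
  rw [Finset.sum_insert (fun h' => h (Finset.mem_of_mem_erase h')), ← Finset.add_sum_erase S _ hx]
  omega

lemma card_insert_erase {S : Finset ℕ} {x y : ℕ} (hx : x ∈ S) (hy : y ∉ S) :
    (insert y (S.erase x)).card = S.card := by
  rw [Finset.card_insert_of_notMem (fun h => hy (Finset.mem_of_mem_erase h)),
    Finset.card_erase_add_one hx]

/-- A partition of a number less than `2 * e` has at most one hook of length `e`. -/
lemma hook_unique {lam : Multiset ℕ} {m e x y : ℕ} (hm : Multiset.card lam ≤ m)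
    (h : lam.sum < 2 * e) (hx : x ∈ betaSet lam m) (hex : e ≤ x) (hx' : x - e ∉ betaSet lam m)
    (hy : y ∈ betaSet lam m) (hey : e ≤ y) (hy' : y - e ∉ betaSet lam m) : x = y := by
  by_contra hxy
  have hyT : y ∈ insert (x - e) ((betaSet lam m).erase x) :=
    Finset.mem_insert_of_mem (Finset.mem_erase.2 ⟨Ne.symm hxy, hy⟩)
  have hyT' : y - e ∉ insert (x - e) ((betaSet lam m).erase x) := fun h' => by
    rcases Finset.mem_insert.1 h' with h' | h'
    · omega
    · exact hy' (Finset.mem_of_mem_erase h')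
  have h₁ := sum_insert_erase hx hex hx'
  have h₂ := sum_insert_erase hyT hey hyT'
  have h₃ := sum_range_card_le_sum
    (insert (y - e) ((insert (x - e) ((betaSet lam m).erase x)).erase y))
  rw [card_insert_erase hyT hyT', card_insert_erase hx hx', card_betaSet] at h₃
  have h₄ := sum_betaSet hm
  omega

lemma altCoeff_update_eq_degSYT {lam mu : Multiset ℕ} {m e : ℕ} {i : Fin m}
    (hm : Multiset.card lam ≤ m) (hpos : ∀ x ∈ mu, 0 < x) (hmu : Multiset.card mu ≤ m)
    (he : e ≤ betaTuple lam m i) (hi : betaTuple lam m i - e ∉ betaSet lam m)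
    (h : betaSet mu m =
      insert (betaTuple lam m i - e) ((betaSet lam m).erase (betaTuple lam m i))) :
    altCoeff (lam.sum - e) (Function.update (betaTuple lam m) i (betaTuple lam m i - e)) =
      (degSYT mu : ZMod 2) := by
  have hinj := (betaTuple_strictAnti lam m).injective
  have hmem (j : Fin m) : betaTuple lam m j ∈ betaSet lam m := by
    rw [betaSet_eq_image]
    exact Finset.mem_image_of_mem _ (Finset.mem_univ j)
  have hsum : mu.sum = lam.sum - e := by
    have h₁ := sum_insert_erase (hmem i) he hi
    rw [← h, sum_betaSet hmu, sum_betaSet hm] at h₁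
    omega
  rw [degSYT_eq_altCoeff hpos hmu, hsum]
  refine altCoeff_eq_of_image_eq _ ?_ (betaTuple_strictAnti mu m).injective ?_
  · intro a b hab
    rcases eq_or_ne a i with ha | ha <;> rcases eq_or_ne b i with hb | hb
    · exact ha.trans hb.symm
    · rw [ha, Function.update_self, Function.update_of_ne hb] at hab
      exact absurd (hab ▸ hmem b) hi
    · subst hb
      rw [Function.update_self, Function.update_of_ne ha] at hab
      exact absurd (hab ▸ hmem a) hi
    · rw [Function.update_of_ne ha, Function.update_of_ne hb] at hab
      exact hinj hab
  · have hr : Set.range (betaTuple mu m) = (betaSet mu m : Set ℕ) := by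
      rw [betaSet_eq_image]
      simp
    rw [hr, h, betaSet_eq_image]
    ext x
    simp only [Set.mem_range, Finset.coe_insert, Finset.coe_erase, Finset.coe_image,
      Finset.coe_univ, Set.image_univ, Set.mem_insert_iff, Set.mem_sdiff, Set.mem_singleton_iff]
    constructor
    · rintro ⟨j, rfl⟩
      rcases eq_or_ne j i with rfl | hj
      · simp
      · rw [Function.update_of_ne hj]
        exact Or.inr ⟨⟨j, rfl⟩, fun h => hj (hinj h)⟩
    · rintro (rfl | ⟨⟨j, rfl⟩, hj⟩)
      · exact ⟨i, Function.update_self _ _ _⟩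
      · exact ⟨j, Function.update_of_ne (fun hji => hj (congrArg _ hji)) _ _⟩

lemma altCoeff_update_eq_zero {lam : Multiset ℕ} {m e : ℕ} (k : ℕ) {i : Fin m} (h0 : 0 < e)
    (he : e ≤ betaTuple lam m i) (hi : betaTuple lam m i - e ∈ betaSet lam m) :
    altCoeff k (Function.update (betaTuple lam m) i (betaTuple lam m i - e)) = 0 := by
  rw [betaSet_eq_image] at hi
  obtain ⟨j, -, hj⟩ := Finset.mem_image.1 hi
  have hij : j ≠ i := by
    rintro rfl
    omega
  exact altCoeff_eq_zero_of_eq k _ hij (by rw [Function.update_self, Function.update_of_ne hij, hj])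

theorem stmt1 (n a1 : ℕ) (hn : 1 ≤ n) (h1 : 2 ^ a1 ≤ n) (h2 : n < 2 ^ (a1 + 1))
    (lam : Multiset ℕ) (hpos : ∀ x ∈ lam, 0 < x) (hsum : lam.sum = n) :
    OddP lam ↔ ∃ mu, IsHookRemoval (2 ^ a1) lam mu ∧ OddP mu := by
  have h0 : 0 < 2 ^ a1 := by positivity
  have hmem {m : ℕ} (i : Fin m) : betaTuple lam m i ∈ betaSet lam m := by
    rw [betaSet_eq_image]
    exact Finset.mem_image_of_mem _ (Finset.mem_univ i)
  have hexp {m : ℕ} (hm : Multiset.card lam ≤ m) : (degSYT lam : ZMod 2) =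
      ∑ i, if 2 ^ a1 ≤ betaTuple lam m i then altCoeff (lam.sum - 2 ^ a1)
        (Function.update (betaTuple lam m) i (betaTuple lam m i - 2 ^ a1)) else 0 := by
    rw [← altCoeff_add_two_pow, Nat.sub_add_cancel (hsum ▸ h1), degSYT_eq_altCoeff hpos hm]
  constructor
  · rintro ⟨-, hodd⟩
    have hne := ZMod.natCast_ne_zero_iff_odd.2 hodd
    rw [hexp le_rfl] at hne
    obtain ⟨i, -, hi⟩ := Finset.exists_ne_zero_of_sum_ne_zero hne
    have he : 2 ^ a1 ≤ betaTuple lam (Multiset.card lam) i := by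
      by_contra he
      exact hi (if_neg he)
    rw [if_pos he] at hi
    have hnot : betaTuple lam (Multiset.card lam) i - 2 ^ a1 ∉ betaSet lam (Multiset.card lam) :=
      fun h => hi (altCoeff_update_eq_zero _ h0 he h)
    obtain ⟨mu, hmu, hcard, hbeta⟩ := exists_betaSet_eq
      (insert (betaTuple lam (Multiset.card lam) i - 2 ^ a1)
        ((betaSet lam (Multiset.card lam)).erase (betaTuple lam (Multiset.card lam) i)))
    rw [card_insert_erase (hmem i) hnot, card_betaSet] at hcard hbeta
    refine ⟨mu, ⟨hpos, hmu, h0, _, _, le_rfl, hcard, hmem i, he, hnot, hbeta⟩, hmu, ?_⟩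
    rw [altCoeff_update_eq_degSYT le_rfl hmu hcard he hnot hbeta] at hi
    exact ZMod.natCast_ne_zero_iff_odd.1 hi
  · rintro ⟨mu, ⟨-, hmu, -, m, x, hm, hcard, hx, he, hnot, hbeta⟩, -, hodd⟩
    refine ⟨hpos, ZMod.natCast_ne_zero_iff_odd.1 ?_⟩
    obtain ⟨i, rfl⟩ : ∃ i, betaTuple lam m i = x := by
      rw [betaSet_eq_image] at hx
      simpa using hx
    rw [hexp hm, Finset.sum_eq_single i, if_pos he,
      altCoeff_update_eq_degSYT hm hmu hcard he hnot hbeta]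
    · exact ZMod.natCast_ne_zero_iff_odd.2 hodd
    · intro j _ hj
      split_ifs with hej
      · refine altCoeff_update_eq_zero _ h0 hej ?_
        by_contra hj'
        exact hj ((betaTuple_strictAnti lam m).injective
          (hook_unique hm (by rw [hsum]; omega) (hmem j) hej hj' (hmem i) he hnot))
      · rfl
    · simp

end OddSym
end

section
/- Let λ be a partition of n and let k ≥ 0. Write Q_2^{(k)}(λ) = (λ_1^{(k)}, …, λ_{2^k}^{(k)}) for row k of the 2-quotient tower of λ. Then λ is odd if and only if the following three conditions all hold: (i) c_2^{(j)}(λ) ≤ 1 for all j < k; (ii) each partition λ_i^{(k)}, 1 ≤ i ≤ 2^k, is odd; (iii) the numbers |λ_i^{(k)}|, 1 ≤ i ≤ 2^k, are pairwise 2-disjoint. Moreover, in that case ∑_{i=1}^{2^k} |λ_i^{(k)}| = ⌊n/2^k⌋. -/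
namespace OddSym

open scoped Classical

section Determinant

open Matrix Finset Polynomial

lemma det_vandermonde_eq_det_descPochhammer {m : ℕ} (x : Fin m → ℤ) :
    (vandermonde x).det = (of fun i j : Fin m => (descPochhammer ℤ j).eval (x i)).det := by
  rw [← det_eval_matrixOfPolynomials_eq_det_vandermonde x (fun j => descPochhammer ℤ j)
    (fun j => descPochhammer_natDegree ℤ j) (fun j => monic_descPochhammer ℤ j)]

/-- Lowering the nodes of a Vandermonde determinant one at a time. -/
lemma sum_mul_det_vandermonde_update {m : ℕ} (x : Fin m → ℤ) :
    ∑ i, x i * (vandermonde (Function.update x i (x i - 1))).det =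
      (∑ i, (x i - (i : ℕ))) * (vandermonde x).det := by
  have hdesc (t : ℤ) (j : ℕ) : t * (descPochhammer ℤ j).eval (t - 1) =
      (t - j) * (descPochhammer ℤ j).eval t := by
    have h := congrArg (Polynomial.eval t) (descPochhammer_succ_left ℤ j)
    rw [descPochhammer_succ_right] at h
    simp [eval_comp] at h
    linarith
  have hterm (i : Fin m) : x i * (vandermonde (Function.update x i (x i - 1))).det =
      ∑ σ : Equiv.Perm (Fin m), (x i - ((σ i : Fin m) : ℕ)) *
        ((Equiv.Perm.sign σ : ℤ) * ∏ l, (descPochhammer ℤ (σ l)).eval (x l)) := by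
    rw [det_vandermonde_eq_det_descPochhammer, ← det_transpose, det_apply', mul_sum]
    refine sum_congr rfl fun σ _ => ?_
    rw [← mul_prod_erase univ _ (mem_univ i), ← mul_prod_erase univ _ (mem_univ i)]
    have hrest : ∏ l ∈ univ.erase i, (of fun i' j : Fin m => (descPochhammer ℤ j).eval
        (Function.update x i (x i - 1) i'))ᵀ (σ l) l =
        ∏ l ∈ univ.erase i, (descPochhammer ℤ (σ l)).eval (x l) := by
      refine prod_congr rfl fun l hl => ?_
      simp [Function.update_of_ne (ne_of_mem_erase hl)]
    rw [hrest]
    simp only [transpose_apply, of_apply, Function.update_self]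
    have := hdesc (x i) (σ i)
    linear_combination ((Equiv.Perm.sign σ : ℤ) *
      ∏ l ∈ univ.erase i, (descPochhammer ℤ (σ l)).eval (x l)) * this
  simp_rw [hterm]
  rw [sum_comm, det_vandermonde_eq_det_descPochhammer, ← det_transpose, det_apply', mul_sum]
  refine sum_congr rfl fun σ _ => ?_
  rw [← sum_mul, sum_sub_distrib, sum_sub_distrib,
    Equiv.sum_comp σ (fun j : Fin m => ((j : ℕ) : ℤ))]
  rfl

end Determinant

section Tuples

open Matrix Finset

/-- The partition formed by the positive entries of a tuple. -/
def partOfTuple {m : ℕ} (p : Fin m → ℕ) : Multiset ℕ :=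
  (univ.val.map p).filter (fun x => 0 < x)

/-- The Vandermonde determinant in the beta-numbers `p i + i`. -/
def betaDet {m : ℕ} (p : Fin m → ℕ) : ℤ :=
  (vandermonde fun i => ((p i : ℤ) + (i : ℕ))).det

lemma sum_filter_pos (s : Multiset ℕ) : (s.filter (fun x => 0 < x)).sum = s.sum := by
  induction s using Multiset.induction_on with
  | empty => simp
  | cons a s ih =>
    by_cases h : 0 < a
    · simp [h, ih]
    · simp [h, ih]; omega

lemma sum_partOfTuple {m : ℕ} (p : Fin m → ℕ) : (partOfTuple p).sum = ∑ i, p i :=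
  sum_filter_pos _

lemma removeBox_partOfTuple {m : ℕ} (p : Fin m → ℕ) (i : Fin m) (hi : 0 < p i) :
    removeBox (partOfTuple p) (p i) = partOfTuple (Function.update p i (p i - 1)) := by
  have key (q : Fin m → ℕ) : univ.val.map q = q i ::ₘ (univ.erase i).val.map q := by
    conv_lhs => rw [← insert_erase (mem_univ i), insert_val_of_notMem (notMem_erase i univ),
      Multiset.map_cons]
  have hrest : (univ.erase i).val.map (Function.update p i (p i - 1)) =
      (univ.erase i).val.map p :=
    Multiset.map_congr rfl fun l hl => Function.update_of_ne (ne_of_mem_erase (Finset.mem_def.2 hl)) _ _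
  unfold partOfTuple removeBox
  rw [key p, key (Function.update p i (p i - 1)), hrest]
  simp only [Function.update_self]
  rw [Multiset.filter_cons_of_pos _ hi, Multiset.erase_cons_head]
  split_ifs with h
  · rw [Multiset.filter_cons_of_neg]; omega
  · rw [Multiset.filter_cons_of_pos]; omega

lemma degSYT_partOfTuple {m : ℕ} (p : Fin m → ℕ) (hp : Monotone p) (h0 : partOfTuple p ≠ 0) :
    degSYT (partOfTuple p) = ∑ i with 0 < p i ∧ ∀ j < i, p j < p i,
      degSYT (partOfTuple (Function.update p i (p i - 1))) := by
  rw [degSYT, dif_neg h0,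
    Finset.sum_attach _ (fun x => degSYT (removeBox (partOfTuple p) x))]
  symm
  refine sum_bij (fun i _ => p i) ?_ ?_ ?_ ?_
  · intro i hi
    simp only [mem_filter, mem_univ, true_and] at hi
    simp [partOfTuple, hi.1]
  · intro i hi j hj hij
    simp only [mem_filter, mem_univ, true_and] at hi hj
    rcases lt_trichotomy i j with h | h | h
    · have := hj.2 i h; omega
    · exact h
    · have := hi.2 j h; omega
  · intro v hv
    simp only [partOfTuple, mem_filter, Multiset.mem_toFinset, Multiset.mem_filter,
      Multiset.mem_map] at hv
    obtain ⟨⟨⟨i, -, rfl⟩, -⟩, hv⟩ := hv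
    have hne : (univ.filter fun j => p j = p i).Nonempty := ⟨i, by simp⟩
    have hmem := min'_mem _ hne
    simp only [mem_filter, mem_univ, true_and] at hmem
    refine ⟨_, ?_, hmem⟩
    simp only [mem_filter, mem_univ, true_and]
    refine ⟨by rwa [hmem], fun j hj => lt_of_le_of_ne (hp hj.le) fun h => ?_⟩
    exact absurd (min'_le _ j (by simpa using h.trans hmem)) (not_le.2 hj)
  · intro i hi
    simp only [mem_filter, mem_univ, true_and] at hi
    rw [removeBox_partOfTuple p i hi.1]

lemma monotone_update_pred {m : ℕ} {p : Fin m → ℕ} (hp : Monotone p) {i : Fin m}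
    (hi : ∀ j < i, p j < p i) : Monotone (Function.update p i (p i - 1)) := by
  intro a b hab
  have h := hp hab
  by_cases ha : a = i <;> by_cases hb : b = i
  · subst ha hb; rfl
  · subst ha; simp [Function.update_of_ne hb]; omega
  · subst hb
    have := hi a (lt_of_le_of_ne hab ha)
    simp [Function.update_of_ne ha]; omega
  · simpa [Function.update_of_ne ha, Function.update_of_ne hb] using h

/-- Frobenius' determinantal formula for the number of standard Young tableaux. -/
theorem degSYT_mul_prod_factorial {m : ℕ} (p : Fin m → ℕ) (hp : Monotone p) :
    (degSYT (partOfTuple p) : ℤ) * ∏ i, ((p i + (i : ℕ)).factorial : ℤ) =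
      ((∑ i, p i).factorial : ℤ) * betaDet p := by
  induction hN : ∑ i, p i generalizing p with
  | zero =>
    have hz : p = fun _ => 0 := by
      funext i
      exact (sum_eq_zero_iff.1 hN) i (mem_univ i)
    subst hz
    have h1 : partOfTuple (fun _ : Fin m => 0) = 0 := by
      refine Multiset.filter_eq_nil.2 fun a ha => ?_
      obtain ⟨_, -, rfl⟩ := Multiset.mem_map.1 ha
      simp
    rw [h1, degSYT, betaDet]
    cases m with
    | zero => simp
    | succ m =>
      have := det_vandermonde_id_eq_superFactorial (R := ℤ) m
      simp only [Nat.cast_zero, zero_add, this, ← Nat.prod_range_factorial_succ]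
      rw [Fin.prod_univ_eq_prod_range (fun i => (i.factorial : ℤ)), prod_range_succ']
      simp [-Nat.prod_range_factorial_succ]
  | succ N ih =>
    have hne : partOfTuple p ≠ 0 := by
      intro h
      have := sum_partOfTuple p
      rw [h, hN] at this
      simp at this
    set x : Fin m → ℤ := fun i => (p i : ℤ) + (i : ℕ) with hx
    have hid := sum_mul_det_vandermonde_update x
    have hsum : ∑ i, (x i - (i : ℕ)) = (N + 1 : ℕ) := by
      rw [← hN]; simp [hx]
    have hoff : ∀ i, ¬(0 < p i ∧ ∀ j < i, p j < p i) →
        x i * (vandermonde (Function.update x i (x i - 1))).det = 0 := by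
      intro i hi
      by_cases hi0 : (i : ℕ) = 0
      · have hpi : p i = 0 := by
          by_contra h
          exact hi ⟨Nat.pos_of_ne_zero h, fun j hj => absurd hj (by
            rw [Fin.lt_def]; omega)⟩
        simp [hx, hpi, hi0]
      · have hlt : (i : ℕ) - 1 < m := by omega
        set j : Fin m := ⟨(i : ℕ) - 1, hlt⟩ with hj
        have hji : j < i := by rw [Fin.lt_def, hj]; simp only; omega
        have hpj : p j = p i := by
          refine le_antisymm (hp hji.le) ?_
          by_contra hcon
          refine hi ⟨by omega, fun l hl => ?_⟩
          have : l ≤ j := by rw [Fin.le_def, hj]; rw [Fin.lt_def] at hl; simp only; omega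
          have := hp this
          omega
        have : (vandermonde (Function.update x i (x i - 1))).det = 0 := by
          rw [det_vandermonde_eq_zero_iff]
          refine ⟨i, j, ?_, hji.ne'⟩
          rw [Function.update_self, Function.update_of_ne hji.ne]
          have hjv : (j : ℕ) + 1 = i := by rw [hj]; simp only; omega
          simp only [hx, hpj]
          omega
        rw [this, mul_zero]
    have hon : ∀ i, (0 < p i ∧ ∀ j < i, p j < p i) →
        (degSYT (partOfTuple (Function.update p i (p i - 1))) : ℤ) *
          ∏ i, ((p i + (i : ℕ)).factorial : ℤ) =
        (N.factorial : ℤ) * (x i * (vandermonde (Function.update x i (x i - 1))).det) := by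
      intro i hi
      set q := Function.update p i (p i - 1) with hq
      have hqi : q i = p i - 1 := by simp [hq]
      have hqj : ∀ j, j ≠ i → q j = p j := fun j hj => by simp [hq, hj]
      have hqsum : ∑ l, q l = N := by
        have h1 := add_sum_erase univ p (mem_univ i)
        have h2 := add_sum_erase univ q (mem_univ i)
        have h3 : ∑ l ∈ univ.erase i, q l = ∑ l ∈ univ.erase i, p l :=
          sum_congr rfl fun l hl => hqj l (ne_of_mem_erase hl)
        have := hi.1
        omega
      have hrec := ih q (monotone_update_pred hp hi.2) hqsum
      have hfac : ∏ l, ((p l + (l : ℕ)).factorial : ℤ) =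
          x i * ∏ l, ((q l + (l : ℕ)).factorial : ℤ) := by
        rw [← mul_prod_erase univ _ (mem_univ i),
          ← mul_prod_erase univ (fun l => ((q l + (l : ℕ)).factorial : ℤ)) (mem_univ i),
          ← mul_assoc]
        congr 1
        · have : p i + (i : ℕ) = (q i + i) + 1 := by have := hi.1; omega
          rw [this, Nat.factorial_succ]
          simp only [hx, Nat.cast_mul]
          congr 1
          rw [← this]; push_cast; rfl
        · exact prod_congr rfl fun l hl => by rw [hqj l (ne_of_mem_erase hl)]
      have hdet : betaDet q = (vandermonde (Function.update x i (x i - 1))).det := by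
        rw [betaDet]
        congr 2
        funext l
        by_cases hl : l = i
        · subst hl
          have := hi.1
          rw [Function.update_self, hqi]
          simp only [hx]
          omega
        · rw [Function.update_of_ne hl, hqj l hl]
      rw [hfac, ← hdet, mul_left_comm, hrec]
      ring
    rw [degSYT_partOfTuple p hp hne, Nat.cast_sum, sum_mul,
      sum_congr rfl fun i hi => hon i (mem_filter.1 hi).2, ← mul_sum,
      sum_filter_of_ne fun i _ h => by
        by_contra hcon
        exact h (hoff i hcon),
      hid, hsum, Nat.factorial_succ, betaDet]
    push_cast
    ring

end Tuples

section BetaSets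

open Finset

/-- The product of all differences `b - a` with `a < b` in `S`. -/
def gapProd (S : Finset ℕ) : ℕ := ∏ b ∈ S, ∏ a ∈ S with a < b, (b - a)

/-- The number of pairs `a < b` in `S`. -/
def pairCount (S : Finset ℕ) : ℕ := ∑ b ∈ S, #{a ∈ S | a < b}

lemma card_filter_lt_le (S : Finset ℕ) (b : ℕ) : #{a ∈ S | a < b} ≤ b := by
  calc #{a ∈ S | a < b} ≤ #(range b) :=
        card_le_card fun a ha => mem_range.2 (mem_filter.1 ha).2
    _ = b := card_range b

lemma sum_partOfBeta (S : Finset ℕ) : (partOfBeta S).sum + pairCount S = ∑ b ∈ S, b := by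
  rw [partOfBeta, sum_filter_pos, pairCount]
  change ∑ b ∈ S, _ + _ = _
  rw [← sum_add_distrib]
  exact sum_congr rfl fun b _ => Nat.sub_add_cancel (card_filter_lt_le S b)

lemma pairCount_mul_two (S : Finset ℕ) : pairCount S * 2 + #S = #S * #S := by
  induction S using Finset.induction_on_max with
  | empty => simp [pairCount]
  | insert m S hm ih =>
    have hmem : m ∉ S := fun h => lt_irrefl _ (hm m h)
    have h1 : pairCount (insert m S) = #S + pairCount S := by
      rw [pairCount, sum_insert hmem]
      congr 1
      · rw [filter_insert, if_neg (lt_irrefl m), filter_true_of_mem hm]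
      · refine sum_congr rfl fun b hb => ?_
        rw [filter_insert, if_neg (hm b hb).not_gt]
    rw [h1, card_insert_of_notMem hmem]
    linarith

lemma strictMono_add_val {m : ℕ} {p : Fin m → ℕ} (hp : Monotone p) :
    StrictMono fun i : Fin m => p i + (i : ℕ) := fun i j hij => by
  have := hp hij.le
  have : (i : ℕ) < j := hij
  simp only
  omega

lemma exists_monotone_image_eq (S : Finset ℕ) :
    ∃ p : Fin #S → ℕ, Monotone p ∧ S = univ.image (fun i => p i + (i : ℕ)) := by
  set b := S.orderEmbOfFin rfl with hb
  have hstep : ∀ k, ∀ i j : Fin #S, (i : ℕ) + k = j → b i + k ≤ b j := by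
    intro k
    induction k with
    | zero =>
      intro i j h
      exact (congrArg b (Fin.ext h)).le
    | succ k ih =>
      intro i j h
      have hlt : (i : ℕ) + k < #S := by have := j.2; omega
      have h1 := ih i ⟨i + k, hlt⟩ rfl
      have h2 : b ⟨i + k, hlt⟩ < b j := b.strictMono (by rw [Fin.lt_def]; simp only; omega)
      omega
  have hle : ∀ i : Fin #S, (i : ℕ) ≤ b i := fun i => by
    have := hstep i ⟨0, i.pos⟩ i (by simp)
    omega
  refine ⟨fun i => b i - i, fun i j hij => ?_, ?_⟩
  · have := hstep (j - i) i j (by have : (i : ℕ) ≤ j := hij; omega)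
    have : (i : ℕ) ≤ j := hij
    have := hle i
    have := hle j
    simp only
    omega
  · conv_lhs => rw [← image_orderEmbOfFin_univ S rfl]
    refine image_congr fun i _ => ?_
    exact (Nat.sub_add_cancel (hle i)).symm

variable {m : ℕ} {p : Fin m → ℕ}

lemma filter_lt_image (hp : Monotone p) (i : Fin m) :
    (univ.image (fun i : Fin m => p i + (i : ℕ))).filter (fun a => a < p i + (i : ℕ)) =
      (Iio i).image (fun i : Fin m => p i + (i : ℕ)) := by
  rw [filter_image]
  congr 1
  ext j
  simpa using (strictMono_add_val hp).lt_iff_lt (a := j) (b := i)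

lemma partOfBeta_image (hp : Monotone p) :
    partOfBeta (univ.image fun i : Fin m => p i + (i : ℕ)) = partOfTuple p := by
  rw [partOfBeta, partOfTuple,
    image_val_of_injOn ((strictMono_add_val hp).injective.injOn), Multiset.map_map]
  congr 1
  refine Multiset.map_congr rfl fun i _ => ?_
  simp only [Function.comp_apply]
  rw [filter_lt_image hp, card_image_of_injective _ (strictMono_add_val hp).injective, Fin.card_Iio]
  omega

lemma gapProd_image (hp : Monotone p) :
    (gapProd (univ.image fun i : Fin m => p i + (i : ℕ)) : ℤ) = betaDet p := by
  rw [gapProd, prod_image (strictMono_add_val hp).injective.injOn, betaDet,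
    Matrix.det_vandermonde]
  push_cast
  rw [prod_comm' (t' := univ) (s' := fun j => Iio j) (by simp)]
  refine prod_congr rfl fun i _ => ?_
  rw [filter_lt_image hp, prod_image (strictMono_add_val hp).injective.injOn]
  refine prod_congr rfl fun j hj => ?_
  rw [Nat.cast_sub (strictMono_add_val hp (mem_Iio.1 hj)).le]
  push_cast
  ring

theorem degSYT_partOfBeta (S : Finset ℕ) :
    degSYT (partOfBeta S) * ∏ b ∈ S, b.factorial =
      (partOfBeta S).sum.factorial * gapProd S := by
  obtain ⟨p, hp, hS⟩ := exists_monotone_image_eq S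
  generalize #S = m at p
  subst hS
  have h := degSYT_mul_prod_factorial p hp
  rw [← gapProd_image hp, ← sum_partOfTuple, ← partOfBeta_image hp] at h
  rw [prod_image (strictMono_add_val hp).injective.injOn]
  exact_mod_cast h

lemma filter_map_range_getD (l : List ℕ) (hl : ∀ x ∈ l, 0 < x) (m : ℕ) (hm : l.length ≤ m) :
    ((List.range m).map fun i => l.getD i 0).filter (fun x => 0 < x) = l := by
  induction m, hm using Nat.le_induction with
  | base =>
    have : ((List.range l.length).map fun i => l.getD i 0) = l := by
      refine List.ext_getElem (by simp) fun i h1 h2 => ?_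
      simp [h2]
    rw [this]
    simpa using hl
  | succ m hm ih =>
    rw [List.range_succ, List.map_append, List.filter_append, ih]
    simp [List.getElem?_eq_none hm]

lemma partOfBeta_betaSet (lam : Multiset ℕ) (hpos : ∀ x ∈ lam, 0 < x) (m : ℕ)
    (hm : Multiset.card lam ≤ m) : partOfBeta (betaSet lam m) = lam := by
  have hcoe : (descList lam : Multiset ℕ) = lam := by
    rw [descList, Multiset.coe_reverse, Multiset.sort_eq]
  have hlen : (descList lam).length = Multiset.card lam := by
    rw [← Multiset.coe_card, hcoe]
  have hanti : ∀ i j, i ≤ j → (descList lam).getD j 0 ≤ (descList lam).getD i 0 := by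
    intro i j hij
    rcases lt_or_ge j (descList lam).length with hj | hj
    · rw [List.getD_eq_getElem _ _ hj, List.getD_eq_getElem _ _ (hij.trans_lt hj)]
      rcases hij.eq_or_lt with rfl | hlt
      · rfl
      · have : (descList lam).Pairwise (fun a b => b ≤ a) := by
          rw [descList, List.pairwise_reverse]
          exact Multiset.pairwise_sort _ _
        exact List.pairwise_iff_getElem.1 this i j (hij.trans_lt hj) hj hlt
    · rw [List.getD_eq_default _ _ hj]
      exact Nat.zero_le _
  set p : Fin m → ℕ := fun i => (descList lam).getD (m - 1 - i) 0 with hpdef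
  have hp : Monotone p := fun i j hij => hanti _ _ (by
    have : (i : ℕ) ≤ j := hij
    omega)
  have himage : betaSet lam m = univ.image fun i : Fin m => p i + (i : ℕ) := by
    ext b
    simp only [betaSet, mem_image, mem_range, mem_univ, true_and, hpdef]
    constructor
    · rintro ⟨i, hi, rfl⟩
      refine ⟨⟨m - 1 - i, by omega⟩, ?_⟩
      rw [show m - 1 - (m - 1 - i) = i by omega]
    · rintro ⟨i, rfl⟩
      refine ⟨m - 1 - i, by omega, ?_⟩
      rw [show m - 1 - (m - 1 - (i : ℕ)) = i by omega]
  rw [himage, partOfBeta_image hp]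
  have hmap : univ.val.map p = ((List.range m).map fun i => (descList lam).getD i 0 : List ℕ) := by
    have h1 : univ.val.map p =
        (univ.val.map (Fin.rev : Fin m → Fin m)).map
          fun i : Fin m => (descList lam).getD (i : ℕ) 0 := by
      rw [Multiset.map_map]
      refine Multiset.map_congr rfl fun i _ => ?_
      simp only [Function.comp_apply, Fin.val_rev, hpdef]
      congr 1
      omega
    have h2 : univ.val.map (Fin.rev : Fin m → Fin m) = univ.val :=
      congrArg Finset.val (map_univ_equiv Fin.revPerm)
    rw [h1, h2, Fin.univ_val_map, List.ofFn_eq_map, ← List.map_coe_finRange_eq_range, List.map_map]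
    rfl
  rw [partOfTuple, hmap, Multiset.filter_coe,
    filter_map_range_getD _ _ m (hlen.trans_le hm), hcoe]
  intro x hx
  exact hpos x (by rw [← hcoe]; exact hx)

end BetaSets

section Halves

open Finset

/-- The positions of the beads of `S` on runner `0` of the 2-abacus. -/
def evenHalf (S : Finset ℕ) : Finset ℕ := (S.filter fun b => b % 2 = 0).image fun b => b / 2

/-- The positions of the beads of `S` on runner `1` of the 2-abacus. -/
def oddHalf (S : Finset ℕ) : Finset ℕ := (S.filter fun b => b % 2 = 1).image fun b => b / 2

lemma sum_halves (S : Finset ℕ) (f : ℕ → ℕ) :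
    ∑ b ∈ S, f b = ∑ x ∈ evenHalf S, f (2 * x) + ∑ x ∈ oddHalf S, f (2 * x + 1) := by
  rw [evenHalf, oddHalf, sum_image, sum_image,
    ← sum_filter_add_sum_filter_not S (fun b => b % 2 = 0)]
  · congr 1
    · refine sum_congr rfl fun b hb => ?_
      have := (mem_filter.1 hb).2
      congr 1; omega
    · refine sum_congr (filter_congr fun b _ => by omega) fun b hb => ?_
      have := (mem_filter.1 hb).2
      congr 1; omega
  · intro a ha b hb h
    have := (mem_filter.1 ha).2
    have := (mem_filter.1 hb).2
    simp only at h
    omega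
  · intro a ha b hb h
    have := (mem_filter.1 ha).2
    have := (mem_filter.1 hb).2
    simp only at h
    omega

lemma card_halves (S : Finset ℕ) : #S = #(evenHalf S) + #(oddHalf S) := by
  simpa using sum_halves S fun _ => 1

lemma card_evenHalf (S : Finset ℕ) : #(evenHalf S) = #{b ∈ S | b % 2 = 0} :=
  card_image_of_injOn fun a ha b hb h => by
    have := (mem_filter.1 ha).2
    have := (mem_filter.1 hb).2
    omega

lemma card_oddHalf (S : Finset ℕ) : #(oddHalf S) = #{b ∈ S | b % 2 = 1} :=
  card_image_of_injOn fun a ha b hb h => by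
    have := (mem_filter.1 ha).2
    have := (mem_filter.1 hb).2
    omega

lemma two_mul_sum_partOfBeta (S : Finset ℕ) :
    2 * ((partOfBeta S).sum : ℤ) =
      4 * ((partOfBeta (evenHalf S)).sum + (partOfBeta (oddHalf S)).sum) +
        ((#(evenHalf S) : ℤ) - #(oddHalf S)) * ((#(evenHalf S) : ℤ) - #(oddHalf S) - 1) := by
  have h := sum_halves S fun b => b
  rw [sum_add_distrib, ← mul_sum, ← mul_sum, ← sum_partOfBeta, ← sum_partOfBeta,
    ← sum_partOfBeta, sum_const, smul_eq_mul] at h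
  have hc := card_halves S
  have h1 := pairCount_mul_two S
  have h2 := pairCount_mul_two (evenHalf S)
  have h3 := pairCount_mul_two (oddHalf S)
  rw [hc] at h1
  push_cast [← @Nat.cast_inj ℤ, -Nat.cast_multiset_sum] at h h1 h2 h3
  linear_combination 2 * h - h1 + 2 * h2 + 2 * h3

lemma betaSet_succ (lam : Multiset ℕ) (m : ℕ) (hm : Multiset.card lam ≤ m) :
    betaSet lam (m + 1) = insert 0 ((betaSet lam m).image (· + 1)) := by
  have hlen : (descList lam).length ≤ m := by
    simpa [descList] using hm
  rw [betaSet, range_add_one, image_insert, betaSet, image_image,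
    List.getD_eq_default _ _ hlen]
  congr 1
  · omega
  · refine image_congr fun i hi => ?_
    have : i < m := mem_range.1 hi
    simp only [Function.comp_apply]
    omega

lemma card_halves_betaSet_succ (lam : Multiset ℕ) (m : ℕ) (hm : Multiset.card lam ≤ m) :
    #(evenHalf (betaSet lam (m + 1))) = #(oddHalf (betaSet lam m)) + 1 ∧
      #(oddHalf (betaSet lam (m + 1))) = #(evenHalf (betaSet lam m)) := by
  rw [betaSet_succ lam m hm, card_evenHalf, card_oddHalf, card_evenHalf, card_oddHalf,
    filter_insert, filter_insert, if_pos rfl, if_neg (by simp),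
    card_insert_of_notMem (by simp), filter_image, filter_image,
    card_image_of_injective _ (add_left_injective 1),
    card_image_of_injective _ (add_left_injective 1)]
  refine ⟨?_, ?_⟩
  · congr 2
    exact filter_congr fun b _ => by omega
  · congr 1
    exact filter_congr fun b _ => by omega

/-- Twice the size of the 2-core in terms of the runner counts `a` and `b` is `(a - b) (a - b - 1)`;
this does not depend on the number of beads. -/
lemma runner_invariant (lam : Multiset ℕ) (m : ℕ) (hm : Multiset.card lam ≤ m) :
    ((#(evenHalf (betaSet lam m)) : ℤ) - #(oddHalf (betaSet lam m))) *
        ((#(evenHalf (betaSet lam m)) : ℤ) - #(oddHalf (betaSet lam m)) - 1) =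
      ((#(evenHalf (betaSet lam (Multiset.card lam))) : ℤ) -
          #(oddHalf (betaSet lam (Multiset.card lam)))) *
        ((#(evenHalf (betaSet lam (Multiset.card lam))) : ℤ) -
          #(oddHalf (betaSet lam (Multiset.card lam))) - 1) := by
  induction m, hm using Nat.le_induction with
  | base => rfl
  | succ m hm ih =>
    obtain ⟨h1, h2⟩ := card_halves_betaSet_succ lam m hm
    rw [← ih, h1, h2]
    push_cast
    ring

lemma sum_partOfBeta_range (a : ℕ) : (partOfBeta (range a)).sum = 0 := by
  have h1 := sum_partOfBeta (range a)
  have h2 := pairCount_mul_two (range a)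
  have h3 := Finset.sum_range_id_mul_two a
  rw [card_range] at h2
  cases a with
  | zero => simp [partOfBeta]
  | succ a =>
    rw [Nat.add_sub_cancel] at h3
    nlinarith

lemma two_mul_sum_coreP (lam : Multiset ℕ) :
    2 * ((coreP 2 lam).sum : ℤ) =
      ((#(evenHalf (betaSet lam (Multiset.card lam))) : ℤ) -
          #(oddHalf (betaSet lam (Multiset.card lam)))) *
        ((#(evenHalf (betaSet lam (Multiset.card lam))) : ℤ) -
          #(oddHalf (betaSet lam (Multiset.card lam))) - 1) := by
  rw [← runner_invariant lam (Multiset.card lam + 2) (by omega)]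
  set T := betaSet lam (Multiset.card lam + 2) with hT
  have hcard : #T ≤ Multiset.card lam + 2 := by
    rw [hT, betaSet]
    exact card_image_le.trans (card_range _).le
  rw [card_halves] at hcard
  set C := (range (2 * (Multiset.card lam + 2))).filter
    (fun x => x / 2 < #{b ∈ T | b % 2 = x % 2}) with hC
  have heven : evenHalf C = range #(evenHalf T) := by
    ext x
    simp only [evenHalf, mem_image, mem_filter, hC, mem_range]
    constructor
    · rintro ⟨y, ⟨⟨-, h1⟩, h2⟩, rfl⟩
      rw [h2] at h1
      rw [← evenHalf, card_evenHalf]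
      exact h1
    · intro h
      rw [← evenHalf] at h
      refine ⟨2 * x, ⟨⟨by omega, ?_⟩, by omega⟩, by omega⟩
      rw [Nat.mul_mod_right, ← card_evenHalf]
      omega
  have hodd : oddHalf C = range #(oddHalf T) := by
    ext x
    simp only [oddHalf, mem_image, mem_filter, hC, mem_range]
    constructor
    · rintro ⟨y, ⟨⟨-, h1⟩, h2⟩, rfl⟩
      rw [h2] at h1
      rw [← oddHalf, card_oddHalf]
      exact h1
    · intro h
      rw [← oddHalf] at h
      refine ⟨2 * x + 1, ⟨⟨by omega, ?_⟩, by omega⟩, by omega⟩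
      rw [show (2 * x + 1) % 2 = 1 by omega, ← card_oddHalf]
      omega
  have h := two_mul_sum_partOfBeta C
  rw [heven, hodd, sum_partOfBeta_range, sum_partOfBeta_range, card_range, card_range] at h
  rw [coreP, ← hT, ← hC, h]
  simp

lemma quot2_eq (lam : Multiset ℕ) :
    quot2 lam = (partOfBeta (evenHalf (betaSet lam (2 * Multiset.card lam))),
      partOfBeta (oddHalf (betaSet lam (2 * Multiset.card lam)))) := rfl

lemma sum_eq_core_add_quot (lam : Multiset ℕ) (hpos : ∀ x ∈ lam, 0 < x) :
    lam.sum = (coreP 2 lam).sum + 2 * ((quot2 lam).1.sum + (quot2 lam).2.sum) := by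
  have h := two_mul_sum_partOfBeta (betaSet lam (2 * Multiset.card lam))
  rw [runner_invariant lam _ (by omega), ← two_mul_sum_coreP,
    partOfBeta_betaSet lam hpos _ (by omega)] at h
  rw [quot2_eq]
  simp only
  omega

end Halves

section Valuation

open Finset

/-- The 2-adic valuation. -/
local notation "v₂" => padicValNat 2

lemma padicValNat_prod_ne_zero {ι : Type*} (s : Finset ι) (f : ι → ℕ) (hf : ∀ i ∈ s, f i ≠ 0) :
    v₂ (∏ i ∈ s, f i) = ∑ i ∈ s, v₂ (f i) := by
  simp_rw [← Nat.factorization_def _ Nat.prime_two]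
  exact Nat.factorization_prod_apply hf

lemma gapProd_pos (S : Finset ℕ) : 0 < gapProd S :=
  prod_pos fun _ _ => prod_pos fun _ ha => Nat.sub_pos_of_lt (mem_filter.1 ha).2

lemma padicValNat_gapProd (S : Finset ℕ) :
    v₂ (gapProd S) = ∑ b ∈ S, ∑ a ∈ S, if a < b then v₂ (b - a) else 0 := by
  rw [gapProd, padicValNat_prod_ne_zero]
  · refine sum_congr rfl fun b _ => ?_
    rw [padicValNat_prod_ne_zero, sum_filter]
    intro a ha
    have := (mem_filter.1 ha).2
    omega
  · intro b _
    exact (prod_pos fun _ ha => Nat.sub_pos_of_lt (mem_filter.1 ha).2).ne'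

lemma padicValNat_gapProd_halves (S : Finset ℕ) :
    v₂ (gapProd S) = v₂ (gapProd (evenHalf S)) + v₂ (gapProd (oddHalf S)) +
      pairCount (evenHalf S) + pairCount (oddHalf S) := by
  have hodd (n : ℕ) (h : n % 2 = 1) : v₂ n = 0 := padicValNat.eq_zero_of_not_dvd (by omega)
  have hdouble (x y : ℕ) (h : y < x) : v₂ (2 * x - 2 * y) = v₂ (x - y) + 1 := by
    rw [← Nat.mul_sub, padicValNat.mul (by norm_num) (by omega), padicValNat_self]
    omega
  have hhalf (T : Finset ℕ) : ∑ x ∈ T, ∑ y ∈ T, (if y < x then v₂ (x - y) + 1 else 0) =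
      v₂ (gapProd T) + pairCount T := by
    rw [padicValNat_gapProd, pairCount, ← sum_add_distrib]
    refine sum_congr rfl fun x _ => ?_
    rw [card_filter, ← sum_add_distrib]
    exact sum_congr rfl fun y _ => by split_ifs <;> rfl
  have he (x : ℕ) : (∑ a ∈ S, if a < 2 * x then v₂ (2 * x - a) else 0) =
      ∑ y ∈ evenHalf S, if y < x then v₂ (x - y) + 1 else 0 := by
    rw [sum_halves S, sum_eq_zero (s := oddHalf S), add_zero]
    · refine sum_congr rfl fun y _ => ?_
      by_cases h : y < x
      · rw [if_pos h, if_pos (by omega), hdouble x y h]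
      · rw [if_neg h, if_neg (by omega)]
    · intro y _
      split_ifs
      · exact hodd _ (by omega)
      · rfl
  have ho (x : ℕ) : (∑ a ∈ S, if a < 2 * x + 1 then v₂ (2 * x + 1 - a) else 0) =
      ∑ y ∈ oddHalf S, if y < x then v₂ (x - y) + 1 else 0 := by
    rw [sum_halves S, sum_eq_zero (s := evenHalf S), zero_add]
    · refine sum_congr rfl fun y _ => ?_
      by_cases h : y < x
      · rw [if_pos h, if_pos (by omega), Nat.add_sub_add_right, hdouble x y h]
      · rw [if_neg h, if_neg (by omega)]
    · intro y _
      split_ifs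
      · exact hodd _ (by omega)
      · rfl
  rw [padicValNat_gapProd, sum_halves S, sum_congr rfl fun x _ => he x,
    sum_congr rfl fun x _ => ho x, hhalf, hhalf]
  omega

lemma padicValNat_factorial_two_mul (x : ℕ) : v₂ (2 * x).factorial = v₂ x.factorial + x :=
  padicValNat_factorial_mul x

lemma padicValNat_factorial_two_mul_add_one (x : ℕ) :
    v₂ (2 * x + 1).factorial = v₂ x.factorial + x := by
  rw [padicValNat_factorial_mul_add x (by norm_num), padicValNat_factorial_mul]

lemma padicValNat_prod_factorial_halves (S : Finset ℕ) :
    v₂ (∏ b ∈ S, b.factorial) =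
      v₂ (∏ x ∈ evenHalf S, x.factorial) + v₂ (∏ x ∈ oddHalf S, x.factorial) +
        ∑ x ∈ evenHalf S, x + ∑ x ∈ oddHalf S, x := by
  have h (T : Finset ℕ) : v₂ (∏ b ∈ T, b.factorial) = ∑ b ∈ T, v₂ b.factorial :=
    padicValNat_prod_ne_zero T _ fun b _ => b.factorial_ne_zero
  rw [h, h, h, sum_halves S]
  simp_rw [padicValNat_factorial_two_mul, padicValNat_factorial_two_mul_add_one]
  rw [sum_add_distrib, sum_add_distrib]
  omega

lemma degSYT_partOfBeta_pos (S : Finset ℕ) : 0 < degSYT (partOfBeta S) := by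
  refine Nat.pos_of_ne_zero fun h => ?_
  have := degSYT_partOfBeta S
  rw [h, zero_mul] at this
  exact (Nat.mul_pos (Nat.factorial_pos _) (gapProd_pos S)).ne this

lemma padicValNat_degSYT (S : Finset ℕ) :
    v₂ (degSYT (partOfBeta S)) + v₂ (∏ b ∈ S, b.factorial) =
      v₂ (partOfBeta S).sum.factorial + v₂ (gapProd S) := by
  rw [← padicValNat.mul (degSYT_partOfBeta_pos S).ne'
    (prod_pos fun b _ => b.factorial_pos).ne', degSYT_partOfBeta,
    padicValNat.mul (Nat.factorial_ne_zero _) (gapProd_pos S).ne']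

lemma padicValNat_degSYT_halves (S : Finset ℕ) :
    v₂ (degSYT (partOfBeta S)) +
        v₂ (partOfBeta (evenHalf S)).sum.factorial + v₂ (partOfBeta (oddHalf S)).sum.factorial +
        (partOfBeta (evenHalf S)).sum + (partOfBeta (oddHalf S)).sum =
      v₂ (partOfBeta S).sum.factorial +
        v₂ (degSYT (partOfBeta (evenHalf S))) + v₂ (degSYT (partOfBeta (oddHalf S))) := by
  have h := padicValNat_degSYT S
  have h0 := padicValNat_degSYT (evenHalf S)
  have h1 := padicValNat_degSYT (oddHalf S)
  have s0 := sum_partOfBeta (evenHalf S)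
  have s1 := sum_partOfBeta (oddHalf S)
  rw [padicValNat_prod_factorial_halves, padicValNat_gapProd_halves] at h
  omega

lemma odd_choose_add_iff (a b : ℕ) : Odd ((a + b).choose a) ↔ a &&& b = 0 := by
  induction a using Nat.strong_induction_on generalizing b with
  | _ a ih =>
    rcases Nat.eq_zero_or_pos a with rfl | ha
    · simp
    have hl := Choose.choose_modEq_choose_mod_mul_choose_div_nat (p := 2) (n := a + b) (k := a)
    have hand : a &&& b = 0 ↔ ¬(a % 2 = 1 ∧ b % 2 = 1) ∧ a / 2 &&& b / 2 = 0 := by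
      have h1 : (a &&& b) / 2 = a / 2 &&& b / 2 := Nat.and_div_two
      have h2 : (a &&& b) % 2 = 1 ↔ a % 2 = 1 ∧ b % 2 = 1 := Nat.and_mod_two_eq_one
      rw [← h1, ← h2]
      omega
    rw [hand, ← ih (a / 2) (by omega), Nat.odd_iff, hl]
    by_cases hab : a % 2 = 1 ∧ b % 2 = 1
    · have : (a + b) % 2 = 0 := by omega
      simp [hab.1, hab.2, this]
    · have hdiv : (a + b) / 2 = a / 2 + b / 2 := by omega
      have hone : ((a + b) % 2).choose (a % 2) = 1 := by
        rcases Nat.mod_two_eq_zero_or_one a with h | h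
        · rw [h, Nat.choose_zero_right]
        · rw [h, show (a + b) % 2 = 1 by omega, Nat.choose_self]
      rw [hdiv, hone, one_mul, ← Nat.odd_iff]
      simp [hab]

lemma odd_iff_padicValNat {n : ℕ} (hn : 0 < n) : Odd n ↔ v₂ n = 0 := by
  rw [← Nat.not_even_iff_odd, even_iff_two_dvd, dvd_iff_padicValNat_ne_zero hn.ne', not_not]

lemma pos_of_mem_partOfBeta {S : Finset ℕ} {x : ℕ} (hx : x ∈ partOfBeta S) : 0 < x :=
  (Multiset.mem_filter.1 hx).2

/-- Macdonald's recursive criterion for odd partitions. -/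
theorem oddP_iff_quot2 (lam : Multiset ℕ) (hpos : ∀ x ∈ lam, 0 < x) :
    OddP lam ↔ (coreP 2 lam).sum ≤ 1 ∧ OddP (quot2 lam).1 ∧ OddP (quot2 lam).2 ∧
      (quot2 lam).1.sum &&& (quot2 lam).2.sum = 0 := by
  set S := betaSet lam (2 * Multiset.card lam) with hS
  have hlam : partOfBeta S = lam := partOfBeta_betaSet lam hpos _ (by omega)
  have hsum := sum_eq_core_add_quot lam hpos
  have hval := padicValNat_degSYT_halves S
  rw [quot2_eq] at hsum ⊢
  simp only [← hS] at hsum ⊢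
  rw [← odd_choose_add_iff, odd_iff_padicValNat (Nat.choose_pos (by omega))]
  have hodd (T : Finset ℕ) : OddP (partOfBeta T) ↔ v₂ (degSYT (partOfBeta T)) = 0 := by
    rw [OddP, odd_iff_padicValNat (degSYT_partOfBeta_pos T)]
    exact and_iff_right fun x => pos_of_mem_partOfBeta
  rw [← hlam, hodd, hodd, hodd, hlam]
  rw [hlam] at hval
  set a := (partOfBeta (evenHalf S)).sum
  set b := (partOfBeta (oddHalf S)).sum
  set c := (coreP 2 lam).sum
  have hfac : v₂ lam.sum.factorial = v₂ (a + b + c / 2).factorial + (a + b + c / 2) := by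
    rw [← padicValNat_mul_div_factorial, padicValNat_factorial_mul, hsum]
    rw [show (c + 2 * (a + b)) / 2 = a + b + c / 2 by omega]
  have hchoose : v₂ (a + b).factorial =
      v₂ ((a + b).choose a) + v₂ a.factorial + v₂ b.factorial := by
    have hne : (a + b).choose a ≠ 0 := (Nat.choose_pos (Nat.le_add_right a b)).ne'
    rw [← Nat.add_choose_mul_factorial_mul_factorial, ← Nat.choose_symm_add,
      padicValNat.mul (Nat.mul_ne_zero hne a.factorial_ne_zero) b.factorial_ne_zero,
      padicValNat.mul hne a.factorial_ne_zero]
  have hmono : v₂ (a + b).factorial ≤ v₂ (a + b + c / 2).factorial :=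
    padicValNat_dvd_iff_le (Nat.factorial_ne_zero _) |>.1
      (pow_padicValNat_dvd.trans (Nat.factorial_dvd_factorial (by omega)))
  have heq : c / 2 = 0 → v₂ (a + b + c / 2).factorial = v₂ (a + b).factorial := fun h => by
    rw [h, add_zero]
  omega

end Valuation

section Tower

lemma add_eq_or_of_and_eq_zero {a b : ℕ} (h : a &&& b = 0) : a + b = a ||| b := by
  induction a using Nat.strong_induction_on generalizing b with
  | _ a ih =>
    rcases Nat.eq_zero_or_pos a with rfl | ha
    · simp
    have h1 : (a &&& b) / 2 = a / 2 &&& b / 2 := Nat.and_div_two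
    have h2 : (a &&& b) % 2 = 1 ↔ a % 2 = 1 ∧ b % 2 = 1 := Nat.and_mod_two_eq_one
    have h3 : (a ||| b) / 2 = a / 2 ||| b / 2 := Nat.or_div_two
    have h4 : (a ||| b) % 2 = 1 ↔ a % 2 = 1 ∨ b % 2 = 1 := Nat.or_mod_two_eq_one
    rw [h] at h1 h2
    have := ih (a / 2) (by omega) h1.symm
    omega

lemma and_add_two_mul_eq_zero_iff {c d a₀ a₁ b₀ b₁ : ℕ} (hc : c ≤ 1) (hd : d ≤ 1)
    (ha : a₀ &&& a₁ = 0) (hb : b₀ &&& b₁ = 0) :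
    (c + 2 * (a₀ + a₁)) &&& (d + 2 * (b₀ + b₁)) = 0 ↔ c + d ≤ 1 ∧
      (a₀ &&& b₀ = 0 ∧ a₀ &&& b₁ = 0) ∧ (a₁ &&& b₀ = 0 ∧ a₁ &&& b₁ = 0) := by
  have hdist : (a₀ + a₁) &&& (b₀ + b₁) = 0 ↔
      (a₀ &&& b₀ = 0 ∧ a₀ &&& b₁ = 0) ∧ (a₁ &&& b₀ = 0 ∧ a₁ &&& b₁ = 0) := by
    rw [add_eq_or_of_and_eq_zero ha, add_eq_or_of_and_eq_zero hb, Nat.and_or_distrib_right,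
      Nat.and_or_distrib_left, Nat.and_or_distrib_left]
    simp only [Nat.or_eq_zero_iff]
  rw [← hdist]
  generalize a₀ + a₁ = a
  generalize b₀ + b₁ = b
  have h1 : ((c + 2 * a) &&& (d + 2 * b)) / 2 = (c + 2 * a) / 2 &&& (d + 2 * b) / 2 :=
    Nat.and_div_two
  have h2 : ((c + 2 * a) &&& (d + 2 * b)) % 2 = 1 ↔ (c + 2 * a) % 2 = 1 ∧ (d + 2 * b) % 2 = 1 :=
    Nat.and_mod_two_eq_one
  rw [show (c + 2 * a) / 2 = a by omega, show (d + 2 * b) / 2 = b by omega] at h1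
  omega

/-- The 2-quotients of the members of a list of partitions. -/
def quotList (L : List (Multiset ℕ)) : List (Multiset ℕ) :=
  L.flatMap fun mu => [(quot2 mu).1, (quot2 mu).2]

/-- Partitions of 2-disjoint sizes. -/
def TwoDisjoint (mu nu : Multiset ℕ) : Prop := mu.sum &&& nu.sum = 0

lemma twoDisjoint_iff_quot2 {mu nu : Multiset ℕ} (hmu : ∀ x ∈ mu, 0 < x) (hnu : ∀ x ∈ nu, 0 < x)
    (omu : OddP mu) (onu : OddP nu) :
    TwoDisjoint mu nu ↔ (coreP 2 mu).sum + (coreP 2 nu).sum ≤ 1 ∧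
      (TwoDisjoint (quot2 mu).1 (quot2 nu).1 ∧ TwoDisjoint (quot2 mu).1 (quot2 nu).2) ∧
      (TwoDisjoint (quot2 mu).2 (quot2 nu).1 ∧ TwoDisjoint (quot2 mu).2 (quot2 nu).2) := by
  obtain ⟨h1, -, -, h2⟩ := (oddP_iff_quot2 mu hmu).1 omu
  obtain ⟨h3, -, -, h4⟩ := (oddP_iff_quot2 nu hnu).1 onu
  unfold TwoDisjoint
  rw [sum_eq_core_add_quot mu hmu, sum_eq_core_add_quot nu hnu,
    and_add_two_mul_eq_zero_iff h1 h3 h2 h4]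

lemma add_sum_map_le_one_iff {α : Type*} (c : ℕ) (L : List α) (f : α → ℕ) :
    c + (L.map f).sum ≤ 1 ↔ c ≤ 1 ∧ (L.map f).sum ≤ 1 ∧ ∀ x ∈ L, c + f x ≤ 1 := by
  induction L with
  | nil => simp
  | cons x L ih =>
    simp only [List.map_cons, List.sum_cons, List.forall_mem_cons]
    constructor
    · intro h
      exact ⟨by omega, by omega, by omega, (ih.1 (by omega)).2.2⟩
    · rintro ⟨h1, h2, h3, h4⟩
      have := ih.2 ⟨h1, by omega, h4⟩
      omega

lemma odd_pairwise_iff_quotList (L : List (Multiset ℕ)) (hL : ∀ mu ∈ L, ∀ x ∈ mu, 0 < x) :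
    ((∀ mu ∈ L, OddP mu) ∧ L.Pairwise TwoDisjoint) ↔
      (L.map fun mu => (coreP 2 mu).sum).sum ≤ 1 ∧
        (∀ mu ∈ quotList L, OddP mu) ∧ (quotList L).Pairwise TwoDisjoint := by
  induction L with
  | nil => simp [quotList]
  | cons x L ih =>
    obtain ⟨hx, hL⟩ := List.forall_mem_cons.1 hL
    specialize ih hL
    have hmem (P : Multiset ℕ → Prop) :
        (∀ mu ∈ quotList L, P mu) ↔ ∀ mu ∈ L, P (quot2 mu).1 ∧ P (quot2 mu).2 := by
      simp [quotList, List.mem_flatMap, or_imp, forall_and]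
      grind
    have hcons : quotList (x :: L) = (quot2 x).1 :: (quot2 x).2 :: quotList L := by
      simp [quotList]
    rw [hcons, List.map_cons, List.sum_cons, add_sum_map_le_one_iff]
    simp only [List.pairwise_cons, List.forall_mem_cons, hmem (TwoDisjoint _)]
    constructor
    · rintro ⟨⟨ox, oL⟩, dx, dL⟩
      obtain ⟨h1, h2, h3⟩ := ih.1 ⟨oL, dL⟩
      obtain ⟨x1, x2, x3, x4⟩ := (oddP_iff_quot2 x hx).1 ox
      have key := fun y hy => (twoDisjoint_iff_quot2 hx (hL y hy) ox (oL y hy)).1 (dx y hy)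
      exact ⟨⟨x1, h1, fun y hy => (key y hy).1⟩, ⟨x2, x3, h2⟩,
        ⟨x4, fun y hy => (key y hy).2.1⟩, fun y hy => (key y hy).2.2, h3⟩
    · rintro ⟨⟨x1, h1, hc⟩, ⟨x2, x3, h2⟩, ⟨x4, d1⟩, d2, h3⟩
      obtain ⟨oL, dL⟩ := ih.2 ⟨h1, h2, h3⟩
      have ox := (oddP_iff_quot2 x hx).2 ⟨x1, x2, x3, x4⟩
      exact ⟨⟨ox, oL⟩, fun y hy => (twoDisjoint_iff_quot2 hx (hL y hy) ox (oL y hy)).2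
        ⟨hc y hy, d1 y hy, d2 y hy⟩, dL⟩

lemma sum_eq_sum_core_add_quotList (L : List (Multiset ℕ)) (hL : ∀ mu ∈ L, ∀ x ∈ mu, 0 < x) :
    (L.map Multiset.sum).sum = (L.map fun mu => (coreP 2 mu).sum).sum +
      2 * ((quotList L).map Multiset.sum).sum := by
  induction L with
  | nil => simp [quotList]
  | cons x L ih =>
    obtain ⟨hx, hL⟩ := List.forall_mem_cons.1 hL
    specialize ih hL
    have hcons : quotList (x :: L) = (quot2 x).1 :: (quot2 x).2 :: quotList L := by
      simp [quotList]
    rw [hcons]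
    simp only [List.map_cons, List.sum_cons]
    rw [ih, sum_eq_core_add_quot x hx]
    ring

variable {lam : Multiset ℕ}

lemma towerRow_succ (k : ℕ) : towerRow (k + 1) lam = quotList (towerRow k lam) := rfl

lemma pos_of_mem_towerRow (hpos : ∀ x ∈ lam, 0 < x) (k : ℕ) :
    ∀ mu ∈ towerRow k lam, ∀ x ∈ mu, 0 < x := by
  cases k with
  | zero => simpa [towerRow] using hpos
  | succ k =>
    intro mu hmu
    rw [towerRow_succ, quotList, List.mem_flatMap] at hmu
    obtain ⟨nu, -, h⟩ := hmu
    simp only [List.mem_cons, List.not_mem_nil, or_false, quot2_eq] at h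
    rcases h with rfl | rfl <;> exact fun x => pos_of_mem_partOfBeta

lemma length_towerRow (k : ℕ) : (towerRow k lam).length = 2 ^ k := by
  induction k with
  | zero => rfl
  | succ k ih =>
    rw [towerRow_succ, quotList, List.length_flatMap]
    simp [ih, pow_succ]

lemma oddP_iff_towerRow (hpos : ∀ x ∈ lam, 0 < x) (k : ℕ) :
    OddP lam ↔ (∀ j < k, ((towerRow j lam).map fun mu => (coreP 2 mu).sum).sum ≤ 1) ∧
      (∀ mu ∈ towerRow k lam, OddP mu) ∧ (towerRow k lam).Pairwise TwoDisjoint := by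
  induction k with
  | zero => simp [towerRow]
  | succ k ih =>
    rw [ih, odd_pairwise_iff_quotList _ (pos_of_mem_towerRow hpos k), towerRow_succ,
      Nat.forall_lt_succ_right, and_assoc]

lemma pairwise_iff_getD (L : List (Multiset ℕ)) :
    L.Pairwise TwoDisjoint ↔ ∀ i j, i < L.length → j < L.length → i ≠ j →
      (L.getD i 0).sum &&& (L.getD j 0).sum = 0 := by
  rw [List.pairwise_iff_getElem]
  constructor
  · intro h i j hi hj hij
    rw [List.getD_eq_getElem _ _ hi, List.getD_eq_getElem _ _ hj]
    rcases lt_or_gt_of_ne hij with hlt | hlt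
    · exact h i j hi hj hlt
    · rw [Nat.and_comm]
      exact h j i hj hi hlt
  · intro h i j hi hj hij
    have := h i j hi hj hij.ne
    rwa [List.getD_eq_getElem _ _ hi, List.getD_eq_getElem _ _ hj] at this

lemma sum_towerRow (hpos : ∀ x ∈ lam, 0 < x) (k : ℕ)
    (hcore : ∀ j < k, ((towerRow j lam).map fun mu => (coreP 2 mu).sum).sum ≤ 1) :
    ((towerRow k lam).map Multiset.sum).sum = lam.sum / 2 ^ k := by
  induction k with
  | zero => simp [towerRow]
  | succ k ih =>
    have h1 := ih fun j hj => hcore j (by omega)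
    have h2 := hcore k (by omega)
    have h3 := sum_eq_sum_core_add_quotList _ (pos_of_mem_towerRow hpos k)
    rw [towerRow_succ, pow_succ, ← Nat.div_div_eq_div_mul, ← h1]
    omega

end Tower

theorem stmt2 (n k : ℕ) (lam : Multiset ℕ) (hpos : ∀ x ∈ lam, 0 < x)
    (hsum : lam.sum = n) :
    (OddP lam ↔
      ((∀ j, j < k → ((towerRow j lam).map (fun mu => (coreP 2 mu).sum)).sum ≤ 1) ∧
        (∀ mu ∈ towerRow k lam, OddP mu) ∧
        (∀ i j, i < 2 ^ k → j < 2 ^ k → i ≠ j →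
          ((towerRow k lam).getD i 0).sum &&& ((towerRow k lam).getD j 0).sum = 0))) ∧
    (OddP lam → ((towerRow k lam).map Multiset.sum).sum = n / 2 ^ k) := by
  rw [oddP_iff_towerRow hpos k, pairwise_iff_getD, length_towerRow, ← hsum]
  exact ⟨Iff.rfl, fun h => sum_towerRow hpos k h.1⟩

end OddSym
end
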